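/- arXiv:2310.08611 — 2 statements merged into one kernel-verified Lean document; each statement's English description precedes it below -/
import Mathlib

section
/- Let n ≥ 1, let V be a real inner product space, let g be a symmetric matrix-valued map on ℝ^{1+n} and write H^{αβ} := g^{αβ} − m^{αβ}. Let Φ : ℝ^{1+n} → V be C¹. Then at every (t,x) with x ≠ 0, setting r := |x|, ∂_r Φ := Σ_{i=1}^n (x_i/r) ∂_i Φ, T_{r0} := Σ_{i=1}^n (x_i/r) T_{i0}, and H^{rα} := Σ_{i=1}^n (x_i/r) H^{iα}, one has: T_{00}(Φ) + T_{r0}(Φ) = (1/2) ( ‖∂_0 Φ + ∂_r Φ‖² + Σ_{i=1}^{n} ‖∂_i Φ − (x_i/r) ∂_r Φ‖² ) − (1/2) H^{00} ‖∂_0 Φ‖² + (1/2) Σ_{i,j=1}^{n} H^{ij} ⟨∂_i Φ, ∂_j Φ⟩ + H^{r0} ‖∂_0 Φ‖² + Σ_{j=1}^{n} H^{rj} ⟨∂_j Φ, ∂_0 Φ⟩. -/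
open scoped BigOperators RealInnerProductSpace

noncomputable section

/-- Standard basis vector of ℝ^{1+n}. -/
def basisVec (n : ℕ) (μ : Fin (n+1)) : Fin (n+1) → ℝ := Pi.single μ 1

/-- Partial derivative ∂_μ of a map defined on ℝ^{1+n}. -/
def pdv {n : ℕ} {V : Type*} [NormedAddCommGroup V] [NormedSpace ℝ V]
    (Φ : (Fin (n+1) → ℝ) → V) (μ : Fin (n+1)) (p : Fin (n+1) → ℝ) : V :=
  fderiv ℝ Φ p (basisVec n μ)

/-- The Minkowski matrix m = diag(−1,1,…,1). -/
def mink (n : ℕ) (μ ν : Fin (n+1)) : ℝ :=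
  if μ = ν then (if μ = 0 then -1 else 1) else 0

/-- The energy tensor T^μ_ν(Φ) built from the (inverse) metric g. -/
def Tup {n : ℕ} {V : Type*} [NormedAddCommGroup V] [InnerProductSpace ℝ V]
    (g : (Fin (n+1) → ℝ) → Fin (n+1) → Fin (n+1) → ℝ)
    (Φ : (Fin (n+1) → ℝ) → V) (μ ν : Fin (n+1)) (p : Fin (n+1) → ℝ) : ℝ :=
  (∑ α, g p μ α * ⟪pdv Φ α p, pdv Φ ν p⟫)
    - (1/2) * (if μ = ν then (1:ℝ) else 0) *
        ∑ α, ∑ β, g p α β * ⟪pdv Φ α p, pdv Φ β p⟫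

/-- The lowered energy tensor T_{μν} := m_{μμ} T^μ_ν (no sum; m diagonal). -/
def Tlow {n : ℕ} {V : Type*} [NormedAddCommGroup V] [InnerProductSpace ℝ V]
    (g : (Fin (n+1) → ℝ) → Fin (n+1) → Fin (n+1) → ℝ)
    (Φ : (Fin (n+1) → ℝ) → V) (μ ν : Fin (n+1)) (p : Fin (n+1) → ℝ) : ℝ :=
  mink n μ μ * Tup g Φ μ ν p

/-- expression of T_{00} + T_{r0} in terms of the good derivatives
and the perturbation H = g − m. -/
theorem stmt4 {n : ℕ} (hn : 1 ≤ n) {V : Type*} [NormedAddCommGroup V] [InnerProductSpace ℝ V]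
    (g : (Fin (n+1) → ℝ) → Fin (n+1) → Fin (n+1) → ℝ)
    (hgsymm : ∀ p μ ν, g p μ ν = g p ν μ)
    (Φ : (Fin (n+1) → ℝ) → V) (hΦ : ContDiff ℝ 1 Φ)
    (p : Fin (n+1) → ℝ) (hx : ∃ i : Fin n, p i.succ ≠ 0) :
    let r : ℝ := Real.sqrt (∑ i : Fin n, (p i.succ)^2)
    let dr : V := ∑ i : Fin n, (p i.succ / r) • pdv Φ i.succ p
    let H : Fin (n+1) → Fin (n+1) → ℝ := fun μ ν => g p μ ν - mink n μ ν
    let Hr : Fin (n+1) → ℝ := fun α => ∑ i : Fin n, (p i.succ / r) * H i.succ α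
    Tlow g Φ 0 0 p + (∑ i : Fin n, (p i.succ / r) * Tlow g Φ i.succ 0 p)
      = (1/2) * (‖pdv Φ 0 p + dr‖^2
            + ∑ i : Fin n, ‖pdv Φ i.succ p - (p i.succ / r) • dr‖^2)
        - (1/2) * H 0 0 * ‖pdv Φ 0 p‖^2
        + (1/2) * (∑ i : Fin n, ∑ j : Fin n,
            H i.succ j.succ * ⟪pdv Φ i.succ p, pdv Φ j.succ p⟫)
        + Hr 0 * ‖pdv Φ 0 p‖^2
        + ∑ j : Fin n, Hr j.succ * ⟪pdv Φ j.succ p, pdv Φ 0 p⟫ := by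
  intro r dr H Hr
  have hpos : 0 < ∑ i : Fin n, (p i.succ)^2 := by
    obtain ⟨i, hi⟩ := hx
    exact Finset.sum_pos' (fun j _ => sq_nonneg _) ⟨i, Finset.mem_univ _, by positivity⟩
  have hr2 : r ^ 2 = ∑ i : Fin n, (p i.succ)^2 := Real.sq_sqrt hpos.le
  have hw : ∑ i : Fin n, (p i.succ / r) ^ 2 = 1 := by
    simp only [div_pow]
    rw [← Finset.sum_div, ← hr2]
    exact div_self (by rw [hr2]; exact hpos.ne')
  have hdr : dr = ∑ i : Fin n, (p i.succ / r) • pdv Φ i.succ p := rfl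
  have hH : H = fun μ ν => g p μ ν - mink n μ ν := rfl
  have hHr : Hr = fun α => ∑ i : Fin n, (p i.succ / r) * H i.succ α := rfl
  clear_value r dr H Hr
  generalize hwd : (fun i : Fin n => p i.succ / r) = w at *
  have hwi : ∀ i : Fin n, p i.succ / r = w i := fun i => by rw [← hwd]
  simp only [hwi] at *
  have hg0 : ∀ j : Fin n, g p j.succ 0 = g p 0 j.succ := fun j => hgsymm _ _ _
  generalize hud : (fun i => pdv Φ i p) = u at *
  have hui : ∀ i, pdv Φ i p = u i := fun i => by rw [← hud]
  simp only [Tlow, Tup, hui] at *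
  have hm0 : mink n 0 0 = -1 := by simp [mink]
  have hms : ∀ i j : Fin n, mink n i.succ j.succ = if i = j then 1 else 0 := by
    intro i j; simp [mink, Fin.succ_ne_zero]
  have hms0 : ∀ i : Fin n, mink n i.succ 0 = 0 := by
    intro i; simp [mink, Fin.succ_ne_zero]
  have e1 : ∑ i : Fin n, ‖u i.succ - w i • dr‖^2
      = (∑ i : Fin n, ‖u i.succ‖^2) - ‖dr‖^2 := by
    have h1 : ∀ i : Fin n, ‖u i.succ - w i • dr‖^2
        = ‖u i.succ‖^2 - 2 * ⟪w i • u i.succ, dr⟫ + (w i)^2 * ‖dr‖^2 := by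
      intro i
      rw [norm_sub_sq_real, norm_smul, mul_pow, Real.norm_eq_abs, sq_abs,
        real_inner_smul_left, real_inner_smul_right]
    simp only [h1, Finset.sum_add_distrib, Finset.sum_sub_distrib, ← Finset.mul_sum,
      ← Finset.sum_mul, hw, ← sum_inner]
    rw [← hdr, real_inner_self_eq_norm_sq]
    ring
  have e2 : ‖u 0 + dr‖^2 = ‖u 0‖^2 + 2 * (∑ i : Fin n, w i * ⟪u i.succ, u 0⟫) + ‖dr‖^2 := by
    rw [norm_add_sq_real, real_inner_comm, hdr, sum_inner]
    simp only [real_inner_smul_left]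
  have e3 : ∑ i : Fin n, ∑ j : Fin n, H i.succ j.succ * ⟪u i.succ, u j.succ⟫
      = (∑ i : Fin n, ∑ j : Fin n, g p i.succ j.succ * ⟪u i.succ, u j.succ⟫)
        - ∑ i : Fin n, ‖u i.succ‖^2 := by
    simp [hH, hms, sub_mul, Finset.sum_sub_distrib]
  have e4 : ∑ j : Fin n, Hr j.succ * ⟪u j.succ, u 0⟫
      = (∑ i : Fin n, w i * ∑ j : Fin n, g p i.succ j.succ * ⟪u j.succ, u 0⟫)
        - ∑ i : Fin n, w i * ⟪u i.succ, u 0⟫ := by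
    simp only [hHr, hH, hms, mul_sub, Finset.sum_sub_distrib, sub_mul]
    congr 1
    · simp only [Finset.sum_mul, Finset.mul_sum]
      rw [Finset.sum_comm]
      simp only [mul_assoc]
    · simp
  have e5 : Hr 0 = ∑ i : Fin n, w i * g p 0 i.succ := by
    simp [hHr, hH, hms0, hg0]
  have e6 : H 0 0 = g p 0 0 + 1 := by simp [hH, hm0]
  have hc : ∀ j : Fin n, ⟪u 0, u j.succ⟫ = ⟪u j.succ, u 0⟫ := fun j => real_inner_comm _ _
  rw [e1, e2, e3, e4, e5, e6]
  simp only [hm0, hms, Fin.succ_ne_zero, if_true, if_false, Fin.sum_univ_succ, hg0, hc,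
    real_inner_self_eq_norm_sq, Finset.sum_add_distrib, mul_add, Finset.sum_mul]
  simp only [mul_zero, zero_mul, sub_zero, one_mul, mul_add, Finset.sum_add_distrib, mul_assoc]
  ring_nf
  rw [Finset.sum_add_distrib]
  ring
end
end

section
/- Weighted energy estimate with a monotone weight on a time slab: let n ≥ 2, let V be a real inner product space, let g : ℝ^{1+n} → ℝ^{(n+1)×(n+1)} be a C¹ family of symmetric matrices with H^{αβ} := g^{αβ} − m^{αβ} satisfying Σ_{μ,ν=0}^{n} |H^{μν}(t,x)| ≤ C̄ for all (t,x), where 0 ≤ C̄ < 1/n. Let ω : ℝ → ℝ be C¹ with ω ≥ 1 and ω′ ≥ 0, let t₁ ≤ t₂, and let Φ : ℝ^{1+n} → V be C² with support of Φ intersected with [t₁,t₂] × ℝⁿ compact. Then there exists a constant C depending only on n and C̄ such that, writing q := |x| − τ, r := |x|, |∇Φ|² := Σ_{μ=0}^{n} ‖∂_μ Φ‖², ∂_r Φ := Σ_i (x_i/r) ∂_i Φ, |H| := Σ_{μ,ν} |H^{μν}|, |∂H| := Σ_{λ,μ,ν} |∂_λ H^{μν}|, and □̃_g Φ := Σ_{α,β}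 g^{αβ} ∂_α ∂_β Φ: ∫_{ℝⁿ} |∇Φ|²(t₂,x) ω(|x|−t₂) dx + ∫_{t₁}^{t₂} ∫_{ℝⁿ} (1/2) ( ‖∂_0 Φ + ∂_r Φ‖² + Σ_{i=1}^{n} ‖∂_i Φ − (x_i/r) ∂_r Φ‖² ) ω′(q) dx dτ ≤ C ( ∫_{ℝⁿ} |∇Φ|²(t₁,x) ω(|x|−t₁) dx + ∫_{t₁}^{t₂} ∫_{ℝⁿ} |H| · |∇Φ|² · ω′(q) dx dτ + ∫_{t₁}^{t₂} ∫_{ℝⁿ} ( ‖□̃_g Φ‖ · |∇Φ| + |∂H| · |∇Φ|² ) ω(q) dx dτ ). -/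
open scoped BigOperators RealInnerProductSpace
open MeasureTheory

noncomputable section

/-- Second partial derivative ∂_α ∂_β. -/
def pdv2 {n : ℕ} {V : Type*} [NormedAddCommGroup V] [NormedSpace ℝ V]
    (Φ : (Fin (n+1) → ℝ) → V) (α β : Fin (n+1)) (p : Fin (n+1) → ℝ) : V :=
  fderiv ℝ (fun q => fderiv ℝ Φ q (basisVec n β)) p (basisVec n α)

/-- The spatial radius r = |x|. -/
def rad (n : ℕ) (x : Fin n → ℝ) : ℝ := Real.sqrt (∑ i, (x i)^2)

/-- |∇Φ|² := Σ_μ ‖∂_μ Φ‖², the square of the full Minkowski gradient norm. -/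
def gradSq {n : ℕ} {V : Type*} [NormedAddCommGroup V] [NormedSpace ℝ V]
    (Φ : (Fin (n+1) → ℝ) → V) (p : Fin (n+1) → ℝ) : ℝ :=
  ∑ μ, ‖pdv Φ μ p‖^2

/-- The radial derivative ∂_r Φ := Σ_i (x_i/r) ∂_i Φ at the point (τ, x). -/
def radDeriv {n : ℕ} {V : Type*} [NormedAddCommGroup V] [NormedSpace ℝ V]
    (Φ : (Fin (n+1) → ℝ) → V) (τ : ℝ) (x : Fin n → ℝ) : V :=
  ∑ i : Fin n, (x i / rad n x) • pdv Φ i.succ (Fin.cons τ x)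

/-- |H| := Σ_{μν} |g^{μν} − m^{μν}|. -/
def Habs {n : ℕ} (g : (Fin (n+1) → ℝ) → Fin (n+1) → Fin (n+1) → ℝ)
    (p : Fin (n+1) → ℝ) : ℝ :=
  ∑ μ, ∑ ν, |g p μ ν - mink n μ ν|

/-- |∂H| := Σ_{λμν} |∂_λ (g^{μν} − m^{μν})|. -/
def dHabs {n : ℕ} (g : (Fin (n+1) → ℝ) → Fin (n+1) → Fin (n+1) → ℝ)
    (p : Fin (n+1) → ℝ) : ℝ :=
  ∑ lam, ∑ μ, ∑ ν, |pdv (fun q => g q μ ν - mink n μ ν) lam p|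

/-- The reduced wave operator □̃_g Φ := Σ_{αβ} g^{αβ} ∂_α ∂_β Φ. -/
def boxg {n : ℕ} {V : Type*} [NormedAddCommGroup V] [NormedSpace ℝ V]
    (g : (Fin (n+1) → ℝ) → Fin (n+1) → Fin (n+1) → ℝ)
    (Φ : (Fin (n+1) → ℝ) → V) (p : Fin (n+1) → ℝ) : V :=
  ∑ α, ∑ β, g p α β • pdv2 Φ α β p

/-- Algebraic multiplier current `P^α`. -/
def Pg {n : ℕ} {V : Type*} [NormedAddCommGroup V] [InnerProductSpace ℝ V]
    (h : Fin (n+1) → Fin (n+1) → ℝ) (u : Fin (n+1) → V) (α : Fin (n+1)) : ℝ :=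
  (∑ β, h α β * inner ℝ (u β) (u 0))
    - if α = 0 then (1/2) * ∑ μ, ∑ ν, h μ ν * inner ℝ (u μ) (u ν) else 0

section alg
variable {n : ℕ} {V : Type*} [NormedAddCommGroup V] [InnerProductSpace ℝ V]

lemma inner_le_sum (u : Fin (n+1) → V) (μ ν : Fin (n+1)) :
    |inner ℝ (u μ) (u ν)| ≤ ∑ κ, ‖u κ‖^2 := by
  have h1 := abs_real_inner_le_norm (u μ) (u ν)
  have h2 : ‖u μ‖^2 ≤ ∑ κ, ‖u κ‖^2 :=
    Finset.single_le_sum (f := fun κ => ‖u κ‖^2) (fun i _ => by positivity) (Finset.mem_univ μ)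
  have h3 : ‖u ν‖^2 ≤ ∑ κ, ‖u κ‖^2 :=
    Finset.single_le_sum (f := fun κ => ‖u κ‖^2) (fun i _ => by positivity) (Finset.mem_univ ν)
  nlinarith [sq_nonneg (‖u μ‖ - ‖u ν‖)]

lemma quad_le (h : Fin (n+1) → Fin (n+1) → ℝ) (c : ℝ) (s : Fin (n+1) → ℝ)
    (hs : ∀ i, |s i| ≤ c) (B : Fin (n+1) → Fin (n+1) → ℝ) (G : ℝ)
    (hB : ∀ i j, |B i j| ≤ G) :
    |∑ μ, ∑ ν, s μ * (h μ ν * B μ ν)| ≤ c * ((∑ μ, ∑ ν, |h μ ν|) * G) := by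
  have hc : 0 ≤ c := (abs_nonneg _).trans (hs 0)
  rw [Finset.sum_mul, Finset.mul_sum]
  refine (Finset.abs_sum_le_sum_abs _ _).trans (Finset.sum_le_sum fun μ _ => ?_)
  rw [Finset.sum_mul, Finset.mul_sum]
  refine (Finset.abs_sum_le_sum_abs _ _).trans (Finset.sum_le_sum fun ν _ => ?_)
  rw [abs_mul, abs_mul]
  gcongr
  · exact hs μ
  · exact hB μ ν

lemma Pg_sum_bound (h : Fin (n+1) → Fin (n+1) → ℝ) (u : Fin (n+1) → V)
    (ξ : Fin (n+1) → ℝ) (hξ : ∀ i, |ξ i| ≤ 1) :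
    |∑ α, ξ α * Pg h u α| ≤ 3/2 * ((∑ μ, ∑ ν, |h μ ν|) * ∑ κ, ‖u κ‖^2) := by
  have e : ∑ α, ξ α * Pg h u α = (∑ μ, ∑ ν, ξ μ * (h μ ν * inner ℝ (u ν) (u 0)))
      - ∑ μ, ∑ ν, (1/2 * ξ 0) * (h μ ν * inner ℝ (u μ) (u ν)) := by
    simp only [Pg, mul_sub, Finset.sum_sub_distrib, mul_ite, mul_zero, Finset.sum_ite_eq',
      Finset.mem_univ, if_true, Finset.mul_sum]
    congr 1
    refine Finset.sum_congr rfl fun i _ => Finset.sum_congr rfl fun j _ => by ring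
  have h1 := quad_le h 1 ξ hξ (fun μ ν => inner ℝ (u ν) (u 0)) _ (fun i j => inner_le_sum u j 0)
  have h2 := quad_le h (1/2) (fun _ => 1/2 * ξ 0)
    (fun i => by rw [abs_mul, abs_of_pos (by norm_num : (0:ℝ) < 1/2)]; linarith [hξ 0])
    (fun μ ν => inner ℝ (u μ) (u ν)) _ (fun i j => inner_le_sum u i j)
  rw [e]
  refine (abs_sub _ _).trans ?_
  linarith

lemma Pg_zero_bound (h : Fin (n+1) → Fin (n+1) → ℝ) (u : Fin (n+1) → V) :
    |Pg h u 0| ≤ 1/2 * ((∑ μ, ∑ ν, |h μ ν|) * ∑ κ, ‖u κ‖^2) := by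
  have e : Pg h u 0 = ∑ μ, ∑ ν, (if μ = 0 then 1/2 else -1/2) * (h μ ν * inner ℝ (u μ) (u ν)) := by
    have : ∀ μ ν : Fin (n+1), (if μ = 0 then (1/2:ℝ) else -1/2) * (h μ ν * inner ℝ (u μ) (u ν))
      = (if μ = 0 then h μ ν * inner ℝ (u μ) (u ν) else 0)
        - 1/2 * (h μ ν * inner ℝ (u μ) (u ν)) := by
      intro μ ν; split_ifs <;> ring
    simp only [this, Finset.sum_sub_distrib, Pg, if_true, ← Finset.mul_sum]
    congr 1
    rw [Finset.sum_comm]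
    simp [real_inner_comm]
  rw [e]
  exact quad_le h (1/2) _ (fun i => by split_ifs <;> norm_num [abs_of_nonneg, abs_div]) _ _
    (fun i j => inner_le_sum u i j)

lemma Pg_add (h k : Fin (n+1) → Fin (n+1) → ℝ) (u : Fin (n+1) → V) (α) :
    Pg (fun μ ν => h μ ν + k μ ν) u α = Pg h u α + Pg k u α := by
  simp only [Pg, add_mul, Finset.sum_add_distrib, mul_add]
  split_ifs <;> ring

lemma mink_sum (B : Fin (n+1) → Fin (n+1) → ℝ) (μ : Fin (n+1)) :
    ∑ ν, mink n μ ν * B μ ν = mink n μ μ * B μ μ := by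
  rw [Finset.sum_eq_single μ]
  · intro b _ hb; simp [mink, Ne.symm hb]
  · simp

lemma Pg_mink_zero (u : Fin (n+1) → V) :
    Pg (mink n) u 0 = - (1/2 * ∑ κ, ‖u κ‖^2) := by
  have h1 := mink_sum (fun μ ν => inner ℝ (u ν) (u 0)) (n := n) 0
  have h2 := fun μ => mink_sum (fun μ ν => inner ℝ (u μ) (u ν)) (n := n) μ
  simp only [Pg, if_true, h1, h2]
  rw [Fin.sum_univ_succ, Fin.sum_univ_succ]
  simp [mink, Fin.succ_ne_zero]
  ring

lemma Pg_mink_succ (u : Fin (n+1) → V) (i : Fin n) :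
    Pg (mink n) u i.succ = inner ℝ (u i.succ) (u 0) := by
  have h1 := mink_sum (fun μ ν => inner ℝ (u ν) (u 0)) (n := n) i.succ
  simp only [Pg, h1]
  simp [mink, Fin.succ_ne_zero]

/-- tangential identity -/
lemma tang_identity (u0 : V) (v : Fin n → V) (y : Fin n → ℝ) (w : V)
    (hw : w = ∑ i, y i • v i) (hy : ∑ i, y i ^ 2 = 1 ∨ w = 0) :
    (1/2:ℝ) * (‖u0 + w‖^2 + ∑ i, ‖v i - y i • w‖^2)
     = 1/2 * (‖u0‖^2 + ∑ i, ‖v i‖^2) + ∑ i, y i * inner ℝ (v i) u0 := by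
  have h1 : ∑ i, ‖v i - y i • w‖^2 = ∑ i, ‖v i‖^2 - 2 * inner ℝ w w + (∑ i, y i^2) * ‖w‖^2 := by
    have : ∀ i, ‖v i - y i • w‖^2 = ‖v i‖^2 - 2 * inner ℝ (y i • v i) w + y i^2 * ‖w‖^2 := by
      intro i
      rw [norm_sub_sq_real, inner_smul_right, real_inner_smul_left, norm_smul, mul_pow]
      simp
    simp only [this, Finset.sum_add_distrib, Finset.sum_sub_distrib, ← Finset.mul_sum,
      ← Finset.sum_mul, ← sum_inner, ← hw]
  have h2 : ∑ i, y i * inner ℝ (v i) u0 = inner ℝ u0 w := by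
    rw [real_inner_comm, hw, sum_inner]
    simp [real_inner_smul_left]
  rw [h1, h2, norm_add_sq_real, real_inner_self_eq_norm_sq]
  rcases hy with hy | hy
  · rw [hy]; ring
  · simp [hy]
end alg

section calcu
variable {n : ℕ} {V : Type*} [NormedAddCommGroup V] [InnerProductSpace ℝ V]

lemma pdv_contDiff {Φ : (Fin (n+1) → ℝ) → V} (h : ContDiff ℝ 2 Φ) (μ : Fin (n+1)) :
    ContDiff ℝ 1 (pdv Φ μ) := by
  have : ContDiff ℝ 1 (fderiv ℝ Φ) := h.fderiv_right (by norm_num)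
  exact this.clm_apply contDiff_const

lemma pdv_continuous {Φ : (Fin (n+1) → ℝ) → V} (h : ContDiff ℝ 1 Φ) (μ : Fin (n+1)) :
    Continuous (pdv Φ μ) := by
  have : Continuous (fderiv ℝ Φ) := h.continuous_fderiv (by norm_num)
  exact this.clm_apply continuous_const

lemma pdv_symm {Φ : (Fin (n+1) → ℝ) → V} (h : ContDiff ℝ 2 Φ) (μ ν : Fin (n+1)) (p) :
    pdv (pdv Φ μ) ν p = pdv (pdv Φ ν) μ p := by
  have hd : DifferentiableAt ℝ (fderiv ℝ Φ) p :=
    (h.fderiv_right (m := 1) (by norm_num)).differentiable (by norm_num) p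
  have key : ∀ μ ν, pdv (pdv Φ μ) ν p = fderiv ℝ (fderiv ℝ Φ) p (basisVec n ν) (basisVec n μ) := by
    intro μ ν
    have := (hd.hasFDerivAt.clm_apply (hasFDerivAt_const (basisVec n μ) p)).fderiv
    unfold pdv
    rw [this]
    simp
  rw [key, key]
  exact (h.contDiffAt.isSymmSndFDerivAt (by simp)) _ _

lemma pdv_Pg {g : (Fin (n+1) → ℝ) → Fin (n+1) → Fin (n+1) → ℝ}
    (hg : ∀ μ ν, ContDiff ℝ 1 (fun p => g p μ ν)) {u : Fin (n+1) → (Fin (n+1) → ℝ) → V}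
    (hu : ∀ μ, ContDiff ℝ 1 (u μ)) (α l : Fin (n+1)) (p : Fin (n+1) → ℝ) :
    pdv (fun p => Pg (g p) (fun μ => u μ p) α) l p =
      Pg (fun μ ν => pdv (fun q => g q μ ν) l p) (fun μ => u μ p) α
      + ((∑ β, g p α β * (inner ℝ (pdv (u β) l p) (u 0 p) + inner ℝ (u β p) (pdv (u 0) l p)))
        - if α = 0 then (1/2) * ∑ μ, ∑ ν, g p μ ν *
            (inner ℝ (pdv (u μ) l p) (u ν p) + inner ℝ (u μ p) (pdv (u ν) l p)) else 0) := by
  have hg' : ∀ μ ν, HasFDerivAt (fun p => g p μ ν) (fderiv ℝ (fun p => g p μ ν) p) p :=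
    fun μ ν => ((hg μ ν).differentiable (by norm_num) p).hasFDerivAt
  have hu' : ∀ μ, HasFDerivAt (u μ) (fderiv ℝ (u μ) p) p :=
    fun μ => ((hu μ).differentiable (by norm_num) p).hasFDerivAt
  have hB := fun μ ν => (hg' μ ν).fun_mul ((hu' μ).inner ℝ (hu' ν))
  have hC := fun β => (hg' α β).fun_mul ((hu' β).inner ℝ (hu' 0))
  have hS := HasFDerivAt.fun_sum (u := Finset.univ) (fun β _ => hC β)
  have hD := (HasFDerivAt.fun_sum (u := Finset.univ) (fun μ _ =>
    HasFDerivAt.fun_sum (u := Finset.univ) (fun ν _ => hB μ ν))).const_mul (1/2 : ℝ)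
  by_cases hα : α = 0
  · have := (hS.fun_sub hD).fderiv
    simp only [Pg, hα, if_true]
    subst hα
    unfold pdv
    rw [this]
    simp [Finset.sum_add_distrib, mul_add, mul_comm, Finset.mul_sum]
    ring
  · have := hS.fderiv
    simp only [Pg, hα, if_false, sub_zero]
    unfold pdv
    rw [this]
    simp [Finset.sum_add_distrib, mul_add, mul_comm]
    ring

lemma Pg_contDiff {g : (Fin (n+1) → ℝ) → Fin (n+1) → Fin (n+1) → ℝ}
    (hg : ∀ μ ν, ContDiff ℝ 1 (fun p => g p μ ν)) {u : Fin (n+1) → (Fin (n+1) → ℝ) → V}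
    (hu : ∀ μ, ContDiff ℝ 1 (u μ)) (α : Fin (n+1)) :
    ContDiff ℝ 1 (fun p => Pg (g p) (fun μ => u μ p) α) := by
  unfold Pg
  refine ContDiff.sub (ContDiff.sum fun β _ => (hg α β).mul ((hu β).inner ℝ (hu 0))) ?_
  split_ifs
  · exact contDiff_const.mul (ContDiff.sum fun μ _ => ContDiff.sum fun ν _ =>
      (hg μ ν).mul ((hu μ).inner ℝ (hu ν)))
  · exact contDiff_const

lemma div_identity {g : (Fin (n+1) → ℝ) → Fin (n+1) → Fin (n+1) → ℝ}
    (hsym : ∀ p μ ν, g p μ ν = g p ν μ)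
    (hg : ∀ μ ν, ContDiff ℝ 1 (fun p => g p μ ν)) {Φ : (Fin (n+1) → ℝ) → V}
    (hΦ : ContDiff ℝ 2 Φ) (p : Fin (n+1) → ℝ) :
    ∑ α, pdv (fun p => Pg (g p) (fun μ => pdv Φ μ p) α) α p =
      inner ℝ (boxg g Φ p) (pdv Φ 0 p)
      + ∑ α, Pg (fun μ ν => pdv (fun q => g q μ ν) α p) (fun μ => pdv Φ μ p) α := by
  simp only [pdv_Pg hg (pdv_contDiff hΦ), Finset.sum_add_distrib, Finset.sum_sub_distrib,
    Finset.sum_ite_eq', Finset.mem_univ, if_true, mul_add]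
  have h1 : inner ℝ (boxg g Φ p) (pdv Φ 0 p)
      = ∑ α, ∑ β, g p α β * inner ℝ (pdv (pdv Φ β) α p) (pdv Φ 0 p) := by
    simp only [boxg, sum_inner, real_inner_smul_left]
    rfl
  have h2 : ∑ α, ∑ β, g p α β * inner ℝ (pdv Φ β p) (pdv (pdv Φ 0) α p)
      = ∑ α, ∑ β, g p α β * inner ℝ (pdv Φ α p) (pdv (pdv Φ β) 0 p) := by
    rw [Finset.sum_comm]
    refine Finset.sum_congr rfl fun i _ => Finset.sum_congr rfl fun j _ => ?_
    rw [hsym, pdv_symm hΦ]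
  have h3 : ∑ α, ∑ β, g p α β * inner ℝ (pdv (pdv Φ α) 0 p) (pdv Φ β p)
      = ∑ α, ∑ β, g p α β * inner ℝ (pdv Φ α p) (pdv (pdv Φ β) 0 p) := by
    rw [Finset.sum_comm]
    refine Finset.sum_congr rfl fun i _ => Finset.sum_congr rfl fun j _ => ?_
    rw [hsym, real_inner_comm]
  rw [h1, h2, h3]
  ring

lemma source_bound {g : (Fin (n+1) → ℝ) → Fin (n+1) → Fin (n+1) → ℝ}
    (hsym : ∀ p μ ν, g p μ ν = g p ν μ)
    (hg : ∀ μ ν, ContDiff ℝ 1 (fun p => g p μ ν)) {Φ : (Fin (n+1) → ℝ) → V}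
    (hΦ : ContDiff ℝ 2 Φ) (p : Fin (n+1) → ℝ) :
    |∑ α, pdv (fun p => Pg (g p) (fun μ => pdv Φ μ p) α) α p| ≤
      3/2 * (‖boxg g Φ p‖ * Real.sqrt (gradSq Φ p) + dHabs g p * gradSq Φ p) := by
  rw [div_identity hsym hg hΦ]
  have h1 : |inner ℝ (boxg g Φ p) (pdv Φ 0 p)| ≤ ‖boxg g Φ p‖ * Real.sqrt (gradSq Φ p) := by
    refine (abs_real_inner_le_norm _ _).trans ?_
    gcongr
    apply Real.le_sqrt_of_sq_le
    exact Finset.single_le_sum (f := fun κ => ‖pdv Φ κ p‖^2) (fun i _ => by positivity)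
      (Finset.mem_univ 0)
  have h2 : |∑ α, Pg (fun μ ν => pdv (fun q => g q μ ν) α p) (fun μ => pdv Φ μ p) α|
      ≤ 3/2 * (dHabs g p * gradSq Φ p) := by
    rw [dHabs, Finset.sum_mul, Finset.mul_sum]
    refine (Finset.abs_sum_le_sum_abs _ _).trans (Finset.sum_le_sum fun l _ => ?_)
    have := Pg_sum_bound (fun μ ν => pdv (fun q => g q μ ν) l p) (fun μ => pdv Φ μ p)
      (fun i => if i = l then 1 else 0) (fun i => by split_ifs <;> simp)
    simp only [ite_mul, one_mul, zero_mul, Finset.sum_ite_eq', Finset.mem_univ, if_true] at this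
    refine this.trans (le_of_eq ?_)
    simp only [pdv, fderiv_sub_const, gradSq]
  have h3 : 0 ≤ ‖boxg g Φ p‖ * Real.sqrt (gradSq Φ p) := by positivity
  refine (abs_add_le _ _).trans ?_
  linarith

/-- Everything vanishes where Φ vanishes locally. -/
lemma pdv_zero_of_notMem {E : Type*} [NormedAddCommGroup E] [NormedSpace ℝ E]
    {Φ : (Fin (n+1) → ℝ) → E} {p} (h : p ∉ tsupport Φ) (μ) : p ∉ tsupport (pdv Φ μ) := by
  intro hp
  apply h
  refine (closure_minimal ?_ (isClosed_tsupport Φ)) hp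
  intro q hq
  by_contra hq'
  apply hq
  have : q ∉ Function.support (fderiv ℝ Φ) := fun hh => hq' (support_fderiv_subset ℝ hh)
  simp only [Function.mem_support, not_not] at this
  simp [pdv, this]

lemma Pg_tsupport {g : (Fin (n+1) → ℝ) → Fin (n+1) → Fin (n+1) → ℝ} {Φ : (Fin (n+1) → ℝ) → V}
    {p} (h : p ∉ tsupport Φ) (α) : p ∉ tsupport (fun p => Pg (g p) (fun μ => pdv Φ μ p) α) := by
  intro hp
  apply h
  refine (closure_minimal ?_ (isClosed_tsupport Φ)) hp
  intro q hq
  by_contra hq'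
  apply hq
  have : ∀ μ, pdv Φ μ q = 0 := fun μ => image_eq_zero_of_notMem_tsupport (pdv_zero_of_notMem hq' μ)
  simp [Pg, this]
end calcu

section integ
variable {n : ℕ}

lemma cons_cont : Continuous (fun z : ℝ × (Fin n → ℝ) => (Fin.cons z.1 z.2 : Fin (n+1) → ℝ)) :=
  Continuous.finCons (A := fun _ => ℝ) continuous_fst continuous_snd

lemma rad_cont : Continuous (rad n) := by
  unfold rad; fun_prop

lemma y_bound (x : Fin n → ℝ) (i : Fin n) : |x i / rad n x| ≤ 1 := by
  rw [abs_div, abs_of_nonneg (show 0 ≤ rad n x from Real.sqrt_nonneg _)]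
  refine div_le_one_of_le₀ ?_ (Real.sqrt_nonneg _)
  exact Real.abs_le_sqrt
    (Finset.single_le_sum (f := fun i => x i ^2) (fun i _ => sq_nonneg _) (Finset.mem_univ i))

lemma y_sq (x : Fin n → ℝ) : ∑ i, (x i / rad n x)^2 = 1 ∨ ∀ i, x i / rad n x = 0 := by
  by_cases h : rad n x = 0
  · right; simp [h]
  · left
    simp only [div_pow, ← Finset.sum_div]
    have : rad n x ^ 2 = ∑ i, x i ^ 2 := Real.sq_sqrt (Finset.sum_nonneg fun i _ => sq_nonneg _)
    rw [← this]
    exact div_self (pow_ne_zero 2 h)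

lemma rad_ne {x : Fin n → ℝ} (hx : x ≠ 0) : ∑ i, x i ^ 2 ≠ 0 := by
  intro h
  apply hx
  rw [Finset.sum_eq_zero_iff_of_nonneg (fun i _ => sq_nonneg _)] at h
  funext i
  simpa using h i (Finset.mem_univ i)

lemma rad_hasFDerivAt {x : Fin n → ℝ} (hx : x ≠ 0) :
    HasFDerivAt (rad n) (∑ i, (x i / rad n x) • (ContinuousLinearMap.proj i :
      (Fin n → ℝ) →L[ℝ] ℝ)) x := by
  have h1 : HasFDerivAt (fun x : Fin n → ℝ => ∑ i, x i ^ 2)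
      (∑ i, (2 * x i) • (ContinuousLinearMap.proj i : (Fin n → ℝ) →L[ℝ] ℝ)) x := by
    apply HasFDerivAt.fun_sum
    intro i _
    have := (ContinuousLinearMap.proj (R := ℝ) (φ := fun _ : Fin n => ℝ) i).hasFDerivAt
      (x := x) |>.pow 2
    simpa using this
  refine (h1.sqrt (rad_ne hx)).congr_fderiv ?_
  symm
  rw [Finset.smul_sum]
  refine Finset.sum_congr rfl fun i _ => ?_
  rw [smul_smul]
  congr 1
  unfold rad
  rw [div_mul_eq_mul_div, one_mul, mul_div_mul_left _ _ two_ne_zero]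

/-- the slab measure -/
abbrev slabM (n : ℕ) (t₁ t₂ : ℝ) : Measure (ℝ × (Fin n → ℝ)) :=
  (volume.restrict (Set.Ioc t₁ t₂)).prod volume

abbrev boxR (n : ℕ) (R : ℝ) : Set (Fin n → ℝ) := Set.Icc (fun _ => -R) (fun _ => R)

lemma integrable_slab {t₁ t₂ R : ℝ} {F : ℝ × (Fin n → ℝ) → ℝ} (hF : Continuous F)
    (hz : ∀ τ ∈ Set.Icc t₁ t₂, ∀ x, x ∉ boxR n R → F (τ, x) = 0) :
    Integrable F (slabM n t₁ t₂) := by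
  have e : slabM n t₁ t₂ = (volume : Measure (ℝ × (Fin n → ℝ))).restrict
      (Set.Ioc t₁ t₂ ×ˢ Set.univ) := by
    rw [slabM, Measure.volume_eq_prod, ← Measure.prod_restrict, Measure.restrict_univ]
  rw [e]
  have h1 : IntegrableOn F (Set.Icc t₁ t₂ ×ˢ boxR n R) volume :=
    hF.continuousOn.integrableOn_compact (isCompact_Icc.prod isCompact_Icc)
  refine h1.of_forall_sdiff_eq_zero (measurableSet_Ioc.prod MeasurableSet.univ) ?_
  rintro ⟨τ, x⟩ ⟨⟨h2, -⟩, h3⟩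
  refine hz τ (Set.Ioc_subset_Icc_self h2) x fun h4 => h3 ⟨Set.Ioc_subset_Icc_self h2, h4⟩

lemma y_meas (i : Fin n) : Measurable (fun x : Fin n → ℝ => x i / rad n x) :=
  (measurable_pi_apply i).div rad_cont.measurable

lemma integrable_slab_y {t₁ t₂ R : ℝ} {F : ℝ × (Fin n → ℝ) → ℝ} (hF : Continuous F)
    (hz : ∀ τ ∈ Set.Icc t₁ t₂, ∀ x, x ∉ boxR n R → F (τ, x) = 0) (i : Fin n) :
    Integrable (fun z => z.2 i / rad n z.2 * F z) (slabM n t₁ t₂) :=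
  (integrable_slab hF hz).bdd_mul (c := 1)
    ((y_meas i).comp measurable_snd).aestronglyMeasurable
    (Filter.Eventually.of_forall fun z => y_bound z.2 i)

lemma integrable_space {R : ℝ} {F : (Fin n → ℝ) → ℝ} (hF : Continuous F)
    (hz : ∀ x, x ∉ boxR n R → F x = 0) : Integrable F := by
  have h1 : IntegrableOn F (boxR n R) volume := hF.continuousOn.integrableOn_compact isCompact_Icc
  exact (integrableOn_iff_integrable_of_support_subset
    (fun x hx => by by_contra h; exact hx (hz x h))).1 h1

lemma integral_slab {t₁ t₂ : ℝ} (ht : t₁ ≤ t₂) {F : ℝ × (Fin n → ℝ) → ℝ}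
    (hF : Integrable F (slabM n t₁ t₂)) :
    ∫ τ in t₁..t₂, ∫ x, F (τ, x) = ∫ z, F z ∂(slabM n t₁ t₂) := by
  rw [intervalIntegral.integral_of_le ht, integral_prod _ hF]

/-- inclusion of space in space-time, linear part -/
def Linc (n : ℕ) : (Fin n → ℝ) →L[ℝ] (Fin (n+1) → ℝ) :=
  ContinuousLinearMap.pi (Fin.cons 0 (fun i => ContinuousLinearMap.proj i))

lemma Linc_apply (v : Fin n → ℝ) : Linc n v = Fin.cons 0 v := by
  funext j
  refine Fin.cases ?_ (fun i => ?_) j <;> simp [Linc]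

lemma Linc_single (i : Fin n) : Linc n (Pi.single i 1) = basisVec n i.succ := by
  rw [Linc_apply]
  funext j
  refine Fin.cases ?_ (fun k => ?_) j
  · simp [basisVec]
  · simp [basisVec, Pi.single_apply]

lemma cons_hasFDerivAt (τ : ℝ) (x : Fin n → ℝ) :
    HasFDerivAt (fun x : Fin n → ℝ => (Fin.cons τ x : Fin (n+1) → ℝ)) (Linc n) x := by
  have : (fun x : Fin n → ℝ => (Fin.cons τ x : Fin (n+1) → ℝ))
      = fun x => basisVec n 0 * (fun _ => τ) + Linc n x := by
    funext x j
    refine Fin.cases ?_ (fun k => ?_) j <;> simp [Linc_apply, basisVec]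
  rw [this]
  exact (Linc n).hasFDerivAt.const_add _

lemma cons_hasDerivAt (τ : ℝ) (x : Fin n → ℝ) :
    HasDerivAt (fun τ : ℝ => (Fin.cons τ x : Fin (n+1) → ℝ)) (basisVec n 0) τ := by
  rw [hasDerivAt_pi]
  intro j
  refine Fin.cases ?_ (fun k => ?_) j
  · simpa [basisVec] using hasDerivAt_id' τ
  · simpa [basisVec] using hasDerivAt_const τ (x k)

lemma slice_div (hn : 1 ≤ n) {R : ℝ} (hR : 0 ≤ R) (τ : ℝ)
    {Q : Fin n → (Fin (n+1) → ℝ) → ℝ}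
    (hQ : ∀ i, ContDiff ℝ 1 (Q i)) {ω : ℝ → ℝ} (hω : ContDiff ℝ 1 ω)
    (hz : ∀ i x, (∃ j, R ≤ |x j|) → Q i (Fin.cons τ x) = 0)
    (hz' : ∀ i μ x, (∃ j, R ≤ |x j|) → pdv (Q i) μ (Fin.cons τ x) = 0) :
    ∫ x : Fin n → ℝ, ∑ i, (pdv (Q i) i.succ (Fin.cons τ x) * ω (rad n x - τ)
      + x i / rad n x * (Q i (Fin.cons τ x) * deriv ω (rad n x - τ))) = 0 := by
  have hcons : Continuous (fun x : Fin n → ℝ => (Fin.cons τ x : Fin (n+1) → ℝ)) :=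
    cons_cont.comp (by fun_prop : Continuous fun x : Fin n → ℝ => (τ, x))
  have hradc : Continuous (fun x : Fin n → ℝ => rad n x - τ) := rad_cont.sub continuous_const
  have hωc : Continuous ω := hω.continuous
  have hω'c : Continuous (deriv ω) := hω.continuous_deriv (by norm_num)
  have hnot : ∀ x : Fin n → ℝ, x ∉ boxR n R → ∃ j, R ≤ |x j| := by
    intro x hx
    by_contra! h
    exact hx ⟨fun j => (abs_lt.1 (h j)).1.le, fun j => (abs_lt.1 (h j)).2.le⟩
  have hint : Integrable (fun x : Fin n → ℝ =>
      ∑ i, (pdv (Q i) i.succ (Fin.cons τ x) * ω (rad n x - τ)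
      + x i / rad n x * (Q i (Fin.cons τ x) * deriv ω (rad n x - τ)))) := by
    refine integrable_finsetSum _ fun i _ => Integrable.add ?_ ?_
    · refine integrable_space (R := R)
        (((pdv_continuous (hQ i) i.succ).comp hcons).mul (hωc.comp hradc)) fun x hx => ?_
      rw [hz' _ _ _ (hnot x hx), zero_mul]
    · refine Integrable.bdd_mul (c := 1) ?_ (y_meas i).aestronglyMeasurable
        (Filter.Eventually.of_forall fun z => y_bound z i)
      refine integrable_space (R := R)
        (((hQ i).continuous.comp hcons).mul (hω'c.comp hradc)) fun x hx => ?_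
      rw [hz _ _ (hnot x hx), zero_mul]
  obtain ⟨m, rfl⟩ : ∃ m, n = m + 1 := ⟨n - 1, by omega⟩
  have hfz : ∀ (i : Fin (m+1)) (x : Fin (m+1) → ℝ), (∃ j, R ≤ |x j|) →
      Q i (Fin.cons τ x) * ω (rad (m+1) x - τ) = 0 := fun i x hx => by rw [hz i x hx, zero_mul]
  have key := integral_divergence_of_hasFDerivAt_off_countable' (fun _ => -R) (fun _ => R)
    (fun _ => by simp only; linarith)
    (fun i x => Q i (Fin.cons τ x) * ω (rad (m+1) x - τ))
    (fun i x => Q i (Fin.cons τ x) • (deriv ω (rad (m+1) x - τ) •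
        ∑ j, (x j / rad (m+1) x) • (ContinuousLinearMap.proj j : (Fin (m+1) → ℝ) →L[ℝ] ℝ))
      + ω (rad (m+1) x - τ) • ((fderiv ℝ (Q i) (Fin.cons τ x)).comp (Linc (m+1))))
    {0} (Set.countable_singleton _)
    (fun i => (((hQ i).continuous.comp hcons).mul (hωc.comp hradc)).continuousOn)
    (by
      rintro x ⟨-, hx⟩ i
      have h1 := (((hQ i).differentiable (by norm_num)
        (Fin.cons τ x)).hasFDerivAt).comp x (cons_hasFDerivAt τ x)
      have h2 := ((hω.differentiable (by norm_num) (rad (m+1) x - τ)).hasDerivAt).comp_hasFDerivAt x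
        ((rad_hasFDerivAt hx).sub_const τ)
      exact h1.fun_mul h2)
  have he : ∀ x : Fin (m+1) → ℝ, (∑ i, (Q i (Fin.cons τ x) • (deriv ω (rad (m+1) x - τ) •
        ∑ j, (x j / rad (m+1) x) • (ContinuousLinearMap.proj j : (Fin (m+1) → ℝ) →L[ℝ] ℝ))
      + ω (rad (m+1) x - τ) • ((fderiv ℝ (Q i) (Fin.cons τ x)).comp (Linc (m+1))))
        (Pi.single i 1)) =
      ∑ i, (pdv (Q i) i.succ (Fin.cons τ x) * ω (rad (m+1) x - τ)
      + x i / rad (m+1) x * (Q i (Fin.cons τ x) * deriv ω (rad (m+1) x - τ))) := by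
    intro x
    refine Finset.sum_congr rfl fun i _ => ?_
    simp [Linc_single, pdv, Pi.single_apply]
    ring
  simp only [he] at key
  have key2 := key hint.integrableOn
  rw [setIntegral_eq_integral_of_forall_compl_eq_zero] at key2
  · rw [key2]
    refine Finset.sum_eq_zero fun i _ => ?_
    have a1 := fun y : Fin m → ℝ => hfz i (Fin.insertNth i R y) ⟨i, by simp [le_abs_self]⟩
    have a2 := fun y : Fin m → ℝ => hfz i (Fin.insertNth i (-R) y) ⟨i, by simp [le_abs_self]⟩
    simp only [a1, a2, integral_zero, sub_zero]
  · intro x hx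
    refine Finset.sum_eq_zero fun i _ => ?_
    rw [hz _ _ (hnot x hx), hz' _ _ _ (hnot x hx)]; simp

lemma time_ftc {P : (Fin (n+1) → ℝ) → ℝ} (hP : ContDiff ℝ 1 P) {ω : ℝ → ℝ} (hω : ContDiff ℝ 1 ω)
    (t₁ t₂ : ℝ) (x : Fin n → ℝ) :
    ∫ τ in t₁..t₂, (pdv P 0 (Fin.cons τ x) * ω (rad n x - τ)
      - P (Fin.cons τ x) * deriv ω (rad n x - τ))
    = P (Fin.cons t₂ x) * ω (rad n x - t₂) - P (Fin.cons t₁ x) * ω (rad n x - t₁) := by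
  have hcons : Continuous (fun τ : ℝ => (Fin.cons τ x : Fin (n+1) → ℝ)) :=
    cons_cont.comp (by fun_prop : Continuous fun τ : ℝ => (τ, x))
  have hradc : Continuous (fun τ : ℝ => rad n x - τ) := by fun_prop
  have hωc : Continuous ω := hω.continuous
  have hω'c : Continuous (deriv ω) := hω.continuous_deriv (by norm_num)
  refine intervalIntegral.integral_eq_sub_of_hasDerivAt
    (f := fun τ => P (Fin.cons τ x) * ω (rad n x - τ)) (fun τ _ => ?_) ?_
  · have h1 := ((hP.differentiable (by norm_num)
        (Fin.cons τ x)).hasFDerivAt).comp_hasDerivAt τ (cons_hasDerivAt τ x)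
    have h2 := ((hω.differentiable (by norm_num) (rad n x - τ)).hasDerivAt).comp τ
        ((hasDerivAt_id τ).const_sub (rad n x))
    refine (h1.fun_mul h2).congr_deriv ?_
    simp [pdv]
    ring
  · exact ((((pdv_continuous hP 0).comp hcons).mul (hωc.comp hradc)).sub
      ((hP.continuous.comp hcons).mul (hω'c.comp hradc))).intervalIntegrable _ _
end integ

section mainsec
variable {n : ℕ}

lemma notMem_box {R : ℝ} {x : Fin n → ℝ} (hx : x ∉ boxR n R) : ∃ j, R ≤ |x j| := by
  by_contra! h
  exact hx ⟨fun j => (abs_lt.1 (h j)).1.le, fun j => (abs_lt.1 (h j)).2.le⟩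

lemma slab_identity (hn : 1 ≤ n) {R : ℝ} (hR : 0 ≤ R) {t₁ t₂ : ℝ} (ht : t₁ ≤ t₂)
    {P : Fin (n+1) → (Fin (n+1) → ℝ) → ℝ}
    (hP : ∀ α, ContDiff ℝ 1 (P α)) {ω : ℝ → ℝ} (hω : ContDiff ℝ 1 ω)
    (hz : ∀ α, ∀ τ ∈ Set.Icc t₁ t₂, ∀ x : Fin n → ℝ, (∃ j, R ≤ |x j|) →
      (Fin.cons τ x : Fin (n+1) → ℝ) ∉ tsupport (P α)) :
    Integrable (fun z : ℝ × (Fin n → ℝ) =>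
      (∑ α, pdv (P α) α (Fin.cons z.1 z.2)) * ω (rad n z.2 - z.1)
        + (- P 0 (Fin.cons z.1 z.2) + ∑ i : Fin n, z.2 i / rad n z.2 * P i.succ (Fin.cons z.1 z.2))
          * deriv ω (rad n z.2 - z.1)) (slabM n t₁ t₂) ∧
    ∫ z, ((∑ α, pdv (P α) α (Fin.cons z.1 z.2)) * ω (rad n z.2 - z.1)
        + (- P 0 (Fin.cons z.1 z.2) + ∑ i : Fin n, z.2 i / rad n z.2 * P i.succ (Fin.cons z.1 z.2))
          * deriv ω (rad n z.2 - z.1)) ∂(slabM n t₁ t₂)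
    = (∫ x : Fin n → ℝ, P 0 (Fin.cons t₂ x) * ω (rad n x - t₂))
      - ∫ x : Fin n → ℝ, P 0 (Fin.cons t₁ x) * ω (rad n x - t₁) := by
  have hradc : Continuous (fun z : ℝ × (Fin n → ℝ) => rad n z.2 - z.1) :=
    (rad_cont.comp continuous_snd).sub continuous_fst
  have hωc : Continuous ω := hω.continuous
  have hω'c : Continuous (deriv ω) := hω.continuous_deriv (by norm_num)
  have z0 : ∀ α, ∀ τ ∈ Set.Icc t₁ t₂, ∀ x : Fin n → ℝ, (∃ j, R ≤ |x j|) →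
      P α (Fin.cons τ x) = 0 := fun α τ hτ x hx =>
    image_eq_zero_of_notMem_tsupport (hz α τ hτ x hx)
  have z1 : ∀ α μ, ∀ τ ∈ Set.Icc t₁ t₂, ∀ x : Fin n → ℝ, (∃ j, R ≤ |x j|) →
      pdv (P α) μ (Fin.cons τ x) = 0 := fun α μ τ hτ x hx =>
    image_eq_zero_of_notMem_tsupport (pdv_zero_of_notMem (hz α τ hτ x hx) μ)
  have i1 : ∀ α μ, Integrable (fun z : ℝ × (Fin n → ℝ) =>
      pdv (P α) μ (Fin.cons z.1 z.2) * ω (rad n z.2 - z.1)) (slabM n t₁ t₂) := fun α μ =>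
    integrable_slab (R := R) (((pdv_continuous (hP α) μ).comp cons_cont).mul (hωc.comp hradc))
      fun τ hτ x hx => by simp only [z1 α μ τ hτ x (notMem_box hx), zero_mul]
  have c2 : ∀ α, Continuous (fun z : ℝ × (Fin n → ℝ) =>
      P α (Fin.cons z.1 z.2) * deriv ω (rad n z.2 - z.1)) := fun α =>
    ((hP α).continuous.comp cons_cont).mul (hω'c.comp hradc)
  have v2 : ∀ α, ∀ τ ∈ Set.Icc t₁ t₂, ∀ x : Fin n → ℝ, x ∉ boxR n R →
      P α (Fin.cons τ x) * deriv ω (rad n x - τ) = 0 := fun α τ hτ x hx => by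
    rw [z0 α τ hτ x (notMem_box hx), zero_mul]
  have iA : Integrable (fun z : ℝ × (Fin n → ℝ) =>
      pdv (P 0) 0 (Fin.cons z.1 z.2) * ω (rad n z.2 - z.1)
        - P 0 (Fin.cons z.1 z.2) * deriv ω (rad n z.2 - z.1)) (slabM n t₁ t₂) :=
    (i1 0 0).sub (integrable_slab (c2 0) (v2 0))
  have iB : Integrable (fun z : ℝ × (Fin n → ℝ) =>
      ∑ i : Fin n, (pdv (P i.succ) i.succ (Fin.cons z.1 z.2) * ω (rad n z.2 - z.1)
        + z.2 i / rad n z.2 * (P i.succ (Fin.cons z.1 z.2) * deriv ω (rad n z.2 - z.1))))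
      (slabM n t₁ t₂) :=
    integrable_finsetSum _ fun i _ =>
      (i1 i.succ i.succ).add (integrable_slab_y (c2 i.succ) (v2 i.succ) i)
  have e : (fun z : ℝ × (Fin n → ℝ) =>
      (∑ α, pdv (P α) α (Fin.cons z.1 z.2)) * ω (rad n z.2 - z.1)
        + (- P 0 (Fin.cons z.1 z.2) + ∑ i : Fin n, z.2 i / rad n z.2 * P i.succ (Fin.cons z.1 z.2))
          * deriv ω (rad n z.2 - z.1)) = fun z =>
      (pdv (P 0) 0 (Fin.cons z.1 z.2) * ω (rad n z.2 - z.1)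
        - P 0 (Fin.cons z.1 z.2) * deriv ω (rad n z.2 - z.1)) +
      ∑ i : Fin n, (pdv (P i.succ) i.succ (Fin.cons z.1 z.2) * ω (rad n z.2 - z.1)
        + z.2 i / rad n z.2 * (P i.succ (Fin.cons z.1 z.2) * deriv ω (rad n z.2 - z.1))) := by
    funext z
    rw [Fin.sum_univ_succ, Finset.sum_add_distrib, ← Finset.sum_mul]
    simp only [← mul_assoc]
    rw [← Finset.sum_mul]
    ring
  rw [e]
  refine ⟨iA.add iB, ?_⟩
  rw [integral_add iA iB, integral_prod_symm _ iA, integral_prod _ iB]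
  have hB : ∫ τ in Set.Ioc t₁ t₂, ∫ x : Fin n → ℝ,
      ∑ i : Fin n, (pdv (P i.succ) i.succ (Fin.cons τ x) * ω (rad n x - τ)
        + x i / rad n x * (P i.succ (Fin.cons τ x) * deriv ω (rad n x - τ))) = 0 := by
    rw [setIntegral_congr_fun (g := fun _ => (0:ℝ)) measurableSet_Ioc]
    · simp
    · intro τ hτ
      have hτ' := Set.Ioc_subset_Icc_self hτ
      exact slice_div hn hR τ (Q := fun i => P i.succ) (fun i => hP i.succ) hω
        (fun i x hx => z0 _ τ hτ' x hx) (fun i μ x hx => z1 _ μ τ hτ' x hx)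
  have hA : ∀ x : Fin n → ℝ, ∫ τ in Set.Ioc t₁ t₂,
      (pdv (P 0) 0 (Fin.cons τ x) * ω (rad n x - τ)
        - P 0 (Fin.cons τ x) * deriv ω (rad n x - τ)) =
      P 0 (Fin.cons t₂ x) * ω (rad n x - t₂) - P 0 (Fin.cons t₁ x) * ω (rad n x - t₁) := by
    intro x
    rw [← intervalIntegral.integral_of_le ht]
    exact time_ftc (hP 0) hω t₁ t₂ x
  have iS : ∀ τ ∈ Set.Icc t₁ t₂, Integrable (fun x : Fin n → ℝ =>
      P 0 (Fin.cons τ x) * ω (rad n x - τ)) := fun τ hτ => by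
    have hh : Continuous fun x : Fin n → ℝ => (τ, x) := by fun_prop
    exact integrable_space (R := R) (((hP 0).continuous.comp (cons_cont.comp hh)).mul
      (hωc.comp (hradc.comp hh))) fun x hx => by rw [z0 0 τ hτ x (notMem_box hx), zero_mul]
  simp only [hA, hB, add_zero]
  exact integral_sub (iS t₂ (Set.right_mem_Icc.2 ht)) (iS t₁ (Set.left_mem_Icc.2 ht))

variable {V : Type*} [NormedAddCommGroup V] [InnerProductSpace ℝ V]

lemma P_split (g : (Fin (n+1) → ℝ) → Fin (n+1) → Fin (n+1) → ℝ) (p) (u : Fin (n+1) → V) (α) :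
    Pg (g p) u α = Pg (mink n) u α + Pg (fun μ ν => g p μ ν - mink n μ ν) u α := by
  rw [← Pg_add]
  simp

lemma flux_lower (g : (Fin (n+1) → ℝ) → Fin (n+1) → Fin (n+1) → ℝ)
    (Φ : (Fin (n+1) → ℝ) → V) (p : Fin (n+1) → ℝ) (x : Fin n → ℝ) :
    (1/2 * gradSq Φ p + ∑ i : Fin n, x i / rad n x * inner ℝ (pdv Φ i.succ p) (pdv Φ 0 p))
      - 3/2 * (Habs g p * gradSq Φ p)
    ≤ - Pg (g p) (fun μ => pdv Φ μ p) 0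
      + ∑ i : Fin n, x i / rad n x * Pg (g p) (fun μ => pdv Φ μ p) i.succ := by
  have h := Pg_sum_bound (fun μ ν => g p μ ν - mink n μ ν) (fun μ => pdv Φ μ p)
    (Fin.cons (-1) (fun i => x i / rad n x)) (fun i => by
      refine Fin.cases ?_ (fun k => ?_) i
      · simp
      · simpa using y_bound x k)
  rw [Fin.sum_univ_succ] at h
  simp only [Fin.cons_zero, Fin.cons_succ] at h
  simp only [P_split g p, Pg_mink_zero, Pg_mink_succ, mul_add, Finset.sum_add_distrib]
  have h2 := (abs_le.1 h).1
  simp only [gradSq, Habs]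
  linarith

lemma energy_bounds (g : (Fin (n+1) → ℝ) → Fin (n+1) → Fin (n+1) → ℝ)
    (Φ : (Fin (n+1) → ℝ) → V) (p : Fin (n+1) → ℝ) (hH : Habs g p ≤ 1/2) :
    1/4 * gradSq Φ p ≤ - Pg (g p) (fun μ => pdv Φ μ p) 0 ∧
    - Pg (g p) (fun μ => pdv Φ μ p) 0 ≤ 3/4 * gradSq Φ p := by
  have h := abs_le.1 (Pg_zero_bound (fun μ ν => g p μ ν - mink n μ ν) (fun μ => pdv Φ μ p))
  rw [P_split g p, Pg_mink_zero]
  have hG : 0 ≤ gradSq Φ p := Finset.sum_nonneg fun i _ => by positivity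
  have h3 : Habs g p * gradSq Φ p ≤ 1/2 * gradSq Φ p := by gcongr
  simp only [gradSq, Habs] at *
  constructor <;> linarith [h.1, h.2]

lemma tang_eq (Φ : (Fin (n+1) → ℝ) → V) (τ : ℝ) (x : Fin n → ℝ) :
    (1/2 : ℝ) * (‖pdv Φ 0 (Fin.cons τ x) + radDeriv Φ τ x‖^2
      + ∑ i : Fin n, ‖pdv Φ i.succ (Fin.cons τ x) - (x i / rad n x) • radDeriv Φ τ x‖^2)
    = 1/2 * gradSq Φ (Fin.cons τ x) + ∑ i : Fin n, x i / rad n x *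
        inner ℝ (pdv Φ i.succ (Fin.cons τ x)) (pdv Φ 0 (Fin.cons τ x)) := by
  rw [tang_identity (pdv Φ 0 (Fin.cons τ x)) (fun i => pdv Φ i.succ (Fin.cons τ x))
    (fun i => x i / rad n x) (radDeriv Φ τ x) rfl]
  · rw [gradSq, Fin.sum_univ_succ]
  · rcases y_sq x with h | h
    · exact Or.inl h
    · right; simp [radDeriv, h]
end mainsec

/-- weighted energy estimate with a monotone weight on a time
slab, with a constant depending only on n and on the smallness bound C̄ for H. -/
theorem stmt17 (n : ℕ) (hn : 2 ≤ n) (Cb : ℝ) (hCb0 : 0 ≤ Cb) (hCb : Cb < 1 / (n : ℝ)) :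
    ∃ C : ℝ, 0 < C ∧
      ∀ (V : Type) (_ : NormedAddCommGroup V) (_ : InnerProductSpace ℝ V),
      ∀ g : (Fin (n+1) → ℝ) → Fin (n+1) → Fin (n+1) → ℝ,
        (∀ p μ ν, g p μ ν = g p ν μ) →
        (∀ μ ν, ContDiff ℝ 1 (fun p => g p μ ν)) →
        (∀ p, Habs g p ≤ Cb) →
      ∀ ω : ℝ → ℝ, ContDiff ℝ 1 ω → (∀ q, 1 ≤ ω q) → (∀ q, 0 ≤ deriv ω q) →
      ∀ t₁ t₂ : ℝ, t₁ ≤ t₂ →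
      ∀ Φ : (Fin (n+1) → ℝ) → V, ContDiff ℝ 2 Φ →
        IsCompact (tsupport Φ ∩ {p : Fin (n+1) → ℝ | t₁ ≤ p 0 ∧ p 0 ≤ t₂}) →
        (∫ x : Fin n → ℝ, gradSq Φ (Fin.cons t₂ x) * ω (rad n x - t₂))
          + (∫ τ in t₁..t₂, ∫ x : Fin n → ℝ,
              (1/2) * (‖pdv Φ 0 (Fin.cons τ x) + radDeriv Φ τ x‖^2
                  + ∑ i : Fin n,
                      ‖pdv Φ i.succ (Fin.cons τ x) - (x i / rad n x) • radDeriv Φ τ x‖^2)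
                * deriv ω (rad n x - τ))
        ≤ C * ((∫ x : Fin n → ℝ, gradSq Φ (Fin.cons t₁ x) * ω (rad n x - t₁))
            + (∫ τ in t₁..t₂, ∫ x : Fin n → ℝ,
                Habs g (Fin.cons τ x) * gradSq Φ (Fin.cons τ x)
                  * deriv ω (rad n x - τ))
            + (∫ τ in t₁..t₂, ∫ x : Fin n → ℝ,
                (‖boxg g Φ (Fin.cons τ x)‖ * Real.sqrt (gradSq Φ (Fin.cons τ x))
                    + dHabs g (Fin.cons τ x) * gradSq Φ (Fin.cons τ x))
                  * ω (rad n x - τ))) := by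
  have hn0 : (0:ℝ) < n := by exact_mod_cast (by omega : 0 < n)
  have hn2 : (2:ℝ) ≤ n := by exact_mod_cast hn
  have hCb2 : Cb ≤ 1/2 := by
    refine hCb.le.trans ?_
    gcongr
  refine ⟨6, by norm_num, ?_⟩
  intro V _ _ g hsym hg hH ω hω hω1 hω' t₁ t₂ ht Φ hΦ hK
  -- a box containing the support
  obtain ⟨R, hR, hsupp⟩ : ∃ R : ℝ, 0 ≤ R ∧ ∀ τ ∈ Set.Icc t₁ t₂, ∀ x : Fin n → ℝ,
      (∃ j, R ≤ |x j|) → (Fin.cons τ x : Fin (n+1) → ℝ) ∉ tsupport Φ := by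
    obtain ⟨R0, hR0⟩ := hK.isBounded.exists_norm_le
    refine ⟨max R0 0 + 1, by positivity, ?_⟩
    rintro τ hτ x ⟨j, hj⟩ hmem
    have h1 := hR0 _ ⟨hmem, by simpa using hτ⟩
    have h2 := norm_le_pi_norm (Fin.cons τ x : Fin (n+1) → ℝ) j.succ
    rw [Fin.cons_succ, Real.norm_eq_abs] at h2
    linarith [le_max_left R0 0]
  have hradc : Continuous (fun z : ℝ × (Fin n → ℝ) => rad n z.2 - z.1) :=
    (rad_cont.comp continuous_snd).sub continuous_fst
  have hωc : Continuous ω := hω.continuous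
  have hω'c : Continuous (deriv ω) := hω.continuous_deriv (by norm_num)
  have hu := pdv_contDiff hΦ
  have hucont : ∀ μ, Continuous (pdv Φ μ) := fun μ => (hu μ).continuous
  have hu0 : ∀ τ ∈ Set.Icc t₁ t₂, ∀ x : Fin n → ℝ, x ∉ boxR n R →
      ∀ μ, pdv Φ μ (Fin.cons τ x) = 0 := fun τ hτ x hx μ =>
    image_eq_zero_of_notMem_tsupport (pdv_zero_of_notMem (hsupp τ hτ x (notMem_box hx)) μ)
  have hG0 : ∀ τ ∈ Set.Icc t₁ t₂, ∀ x : Fin n → ℝ, x ∉ boxR n R →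
      gradSq Φ (Fin.cons τ x) = 0 := fun τ hτ x hx => by
    simp [gradSq, hu0 τ hτ x hx]
  have hGnn : ∀ p, 0 ≤ gradSq Φ p := fun p => Finset.sum_nonneg fun i _ => by positivity
  have hGc : Continuous (gradSq Φ) := by
    unfold gradSq
    exact continuous_finsetSum _ fun μ _ => (hucont μ).norm.pow 2
  have hHc : Continuous (Habs g) := by
    unfold Habs
    exact continuous_finsetSum _ fun μ _ => continuous_finsetSum _ fun ν _ =>
      ((hg μ ν).continuous.sub continuous_const).abs
  have hdHc : Continuous (dHabs g) := by
    unfold dHabs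
    exact continuous_finsetSum _ fun l _ => continuous_finsetSum _ fun μ _ =>
      continuous_finsetSum _ fun ν _ =>
        (pdv_continuous ((hg μ ν).sub contDiff_const) l).abs
  have hbc : Continuous (boxg g Φ) := by
    unfold boxg
    exact continuous_finsetSum _ fun μ _ => continuous_finsetSum _ fun ν _ =>
      (hg μ ν).continuous.smul (pdv_continuous (hu ν) μ)
  obtain ⟨iM, eM⟩ := slab_identity (by omega) hR ht (fun α => Pg_contDiff hg hu α) hω
    (fun α τ hτ x hx => Pg_tsupport (hsupp τ hτ x hx) α)
  -- the three space-time integrands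
  have iT : Integrable (fun z : ℝ × (Fin n → ℝ) => (1/2) * (‖pdv Φ 0 (Fin.cons z.1 z.2) + radDeriv Φ z.1 z.2‖^2
                  + ∑ i : Fin n,
                      ‖pdv Φ i.succ (Fin.cons z.1 z.2) - (z.2 i / rad n z.2) • radDeriv Φ z.1 z.2‖^2)
                * deriv ω (rad n z.2 - z.1)) (slabM n t₁ t₂) := by
    simp only [tang_eq, add_mul, Finset.sum_mul]
    refine Integrable.add ?_ (integrable_finsetSum _ fun i _ => ?_)
    · refine integrable_slab (R := R)
        ((continuous_const.mul (hGc.comp cons_cont)).mul (hω'c.comp hradc)) fun τ hτ x hx => ?_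
      simp only [hG0 τ hτ x hx, mul_zero, zero_mul]
    · simp only [mul_assoc]
      refine integrable_slab_y (R := R) ((((hucont i.succ).comp cons_cont).inner
        ((hucont 0).comp cons_cont)).mul (hω'c.comp hradc)) (fun τ hτ x hx => ?_) i
      simp only [Pi.mul_apply, Function.comp, hu0 τ hτ x hx, inner_zero_left, zero_mul]
  have iH : Integrable (fun z : ℝ × (Fin n → ℝ) => Habs g (Fin.cons z.1 z.2)
      * gradSq Φ (Fin.cons z.1 z.2) * deriv ω (rad n z.2 - z.1)) (slabM n t₁ t₂) := by
    refine integrable_slab (R := R)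
        (((hHc.comp cons_cont).mul (hGc.comp cons_cont)).mul (hω'c.comp hradc)) fun τ hτ x hx => ?_
    simp only [hG0 τ hτ x hx, mul_zero, zero_mul]
  have iS : Integrable (fun z : ℝ × (Fin n → ℝ) =>
      (‖boxg g Φ (Fin.cons z.1 z.2)‖ * Real.sqrt (gradSq Φ (Fin.cons z.1 z.2))
                    + dHabs g (Fin.cons z.1 z.2) * gradSq Φ (Fin.cons z.1 z.2))
                  * ω (rad n z.2 - z.1)) (slabM n t₁ t₂) := by
    refine integrable_slab (R := R)
        ((((hbc.comp cons_cont).norm.mul (hGc.comp cons_cont).sqrt).add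
          ((hdHc.comp cons_cont).mul (hGc.comp cons_cont))).mul (hωc.comp hradc))
        fun τ hτ x hx => ?_
    simp only [hG0 τ hτ x hx, mul_zero, zero_mul, Real.sqrt_zero, add_zero]
  have eT := integral_slab ht iT
  have eH := integral_slab ht iH
  have eS := integral_slab ht iS
  simp only at eT eH eS
  rw [eT, eH, eS]
  -- time slices
  have hslice : ∀ τ : ℝ, Continuous fun x : Fin n → ℝ => (τ, x) := fun τ => by fun_prop
  have iG : ∀ τ ∈ Set.Icc t₁ t₂, Integrable (fun x : Fin n → ℝ =>
      gradSq Φ (Fin.cons τ x) * ω (rad n x - τ)) := fun τ hτ =>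
    integrable_space (R := R) ((hGc.comp (cons_cont.comp (hslice τ))).mul
      (hωc.comp (hradc.comp (hslice τ)))) fun x hx => by rw [hG0 τ hτ x hx, zero_mul]
  have iP : ∀ τ ∈ Set.Icc t₁ t₂, Integrable (fun x : Fin n → ℝ =>
      Pg (g (Fin.cons τ x)) (fun μ => pdv Φ μ (Fin.cons τ x)) 0 * ω (rad n x - τ)) := fun τ hτ =>
    integrable_space (R := R) (((Pg_contDiff hg hu 0).continuous.comp
      (cons_cont.comp (hslice τ))).mul
      (hωc.comp (hradc.comp (hslice τ)))) fun x hx => by simp [Pg, hu0 τ hτ x hx]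
  have ω0 : ∀ q, 0 ≤ ω q := fun q => zero_le_one.trans (hω1 q)
  have b2 : 1/4 * (∫ x : Fin n → ℝ, gradSq Φ (Fin.cons t₂ x) * ω (rad n x - t₂)) ≤
      - ∫ x : Fin n → ℝ, Pg (g (Fin.cons t₂ x)) (fun μ => pdv Φ μ (Fin.cons t₂ x)) 0
        * ω (rad n x - t₂) := by
    have h2 := Set.right_mem_Icc.2 ht
    rw [← integral_const_mul, ← integral_neg]
    refine integral_mono ((iG t₂ h2).const_mul _) (iP t₂ h2).neg fun x => ?_
    have := (energy_bounds g Φ (Fin.cons t₂ x) ((hH _).trans hCb2)).1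
    have := mul_le_mul_of_nonneg_right this (ω0 (rad n x - t₂))
    simp only
    linarith
  have b1 : - (∫ x : Fin n → ℝ, Pg (g (Fin.cons t₁ x)) (fun μ => pdv Φ μ (Fin.cons t₁ x)) 0
        * ω (rad n x - t₁)) ≤
      3/4 * (∫ x : Fin n → ℝ, gradSq Φ (Fin.cons t₁ x) * ω (rad n x - t₁)) := by
    have h2 := Set.left_mem_Icc.2 ht
    rw [← integral_const_mul, ← integral_neg]
    refine integral_mono (iP t₁ h2).neg ((iG t₁ h2).const_mul _) fun x => ?_
    have := (energy_bounds g Φ (Fin.cons t₁ x) ((hH _).trans hCb2)).2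
    have := mul_le_mul_of_nonneg_right this (ω0 (rad n x - t₁))
    simp only
    linarith
  have n1 : 0 ≤ ∫ x : Fin n → ℝ, gradSq Φ (Fin.cons t₁ x) * ω (rad n x - t₁) :=
    integral_nonneg fun x => mul_nonneg (hGnn _) (ω0 _)
  have nT : 0 ≤ ∫ z : ℝ × (Fin n → ℝ), (1/2) * (‖pdv Φ 0 (Fin.cons z.1 z.2) + radDeriv Φ z.1 z.2‖^2
                  + ∑ i : Fin n,
                      ‖pdv Φ i.succ (Fin.cons z.1 z.2) - (z.2 i / rad n z.2) • radDeriv Φ z.1 z.2‖^2)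
                * deriv ω (rad n z.2 - z.1) ∂(slabM n t₁ t₂) :=
    integral_nonneg fun z => mul_nonneg (by positivity) (hω' _)
  have main := integral_mono ((iT.sub (iH.const_mul (3/2))).sub (iS.const_mul (3/2))) iM (fun z => by
    have f1 := mul_le_mul_of_nonneg_right (flux_lower g Φ (Fin.cons z.1 z.2) z.2)
      (hω' (rad n z.2 - z.1))
    have f2 := mul_le_mul_of_nonneg_right
      (abs_le.1 (source_bound hsym hg hΦ (Fin.cons z.1 z.2))).1 (ω0 (rad n z.2 - z.1))
    simp only [Pi.sub_apply, tang_eq]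
    linarith)
  rw [eM] at main
  rw [integral_sub' (iT.sub (iH.const_mul (3/2))) (iS.const_mul (3/2)),
    integral_sub' iT (iH.const_mul (3/2)), integral_const_mul, integral_const_mul] at main
  linarith
end
end
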